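/- Let n, d, N, k be positive integers and let 𝒜 : ℝ^{n×d} → ℝ^N be a linear map satisfying the 2k-restricted isometry property with constant δ_{2k} ∈ [0,1). Let B̂*, B̂_t ∈ ℝ^{d×k} each have orthonormal columns, and define the linear operator C : ℝ^{n×k} → ℝ^{n×k} by C(U) := (𝒜*𝒜(U B̂*ᵀ)) B̂_t. Then for every U ∈ ℝ^{n×k} with ‖U‖_F = 1, ‖C(U)‖_F² ≥ 1 − dist²(B̂_t, B̂*) − δ_{2k}·(1 + √k + k·δ_{2k}); equivalently, the smallest singular value σ_min(C) of C (as an operator on ℝ^{n×k} with the Frobenius norm) satisfies σ_min²(C) ≥ 1 − dist²(B̂_t, B̂*) − δ_{2k}·(1 + √k + k·δ_{2k}). -/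

import Mathlib

open Matrix MeasureTheory ProbabilityTheory
open scoped RealInnerProductSpace BigOperators

/-- Frobenius norm of a real matrix. -/
noncomputable def frobNorm {m n : ℕ} (M : Matrix (Fin m) (Fin n) ℝ) : ℝ :=
  Real.sqrt (∑ i, ∑ j, M i j ^ 2)

/-- Spectral (ℓ²-operator) norm of a real matrix. -/
noncomputable def specNorm {m n : ℕ} (M : Matrix (Fin m) (Fin n) ℝ) : ℝ :=
  ‖LinearMap.toContinuousLinearMap (Matrix.toEuclideanLin M)‖

/-- Principal-angle distance between the column spans of two `d × k` matrices
with orthonormal columns: `dist(B, B*) = ‖B*ᵀ (B Bᵀ - I)‖₂`. -/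
noncomputable def pdist {d k : ℕ} (B Bstar : Matrix (Fin d) (Fin k) ℝ) : ℝ :=
  specNorm (Bstarᵀ * (B * Bᵀ - 1))

/-- The `k`-restricted isometry property with constant `δ` for a linear map from
`n × d` matrices to `ℝ^N`. -/
def RIP {n d N : ℕ} (A : Matrix (Fin n) (Fin d) ℝ →ₗ[ℝ] EuclideanSpace ℝ (Fin N))
    (k : ℕ) (δ : ℝ) : Prop :=
  ∀ M : Matrix (Fin n) (Fin d) ℝ, M.rank ≤ k →
    (1 - δ) * frobNorm M ^ 2 ≤ ‖A M‖ ^ 2 ∧ ‖A M‖ ^ 2 ≤ (1 + δ) * frobNorm M ^ 2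

lemma frob_sq {m n : ℕ} (M : Matrix (Fin m) (Fin n) ℝ) : frobNorm M ^ 2 = Matrix.trace (Mᵀ * M) := by
  rw [frobNorm, Real.sq_sqrt (by positivity), Finset.sum_comm]
  simp [Matrix.trace, Matrix.mul_apply, sq]

lemma tr_symm {m n : ℕ} (M L : Matrix (Fin m) (Fin n) ℝ) :
    Matrix.trace (Lᵀ * M) = Matrix.trace (Mᵀ * L) := by
  rw [← Matrix.trace_transpose]; simp

lemma frob_sub {m n : ℕ} (M L : Matrix (Fin m) (Fin n) ℝ) :
    frobNorm (M - L) ^ 2 = frobNorm M ^ 2 - 2 * Matrix.trace (Mᵀ * L) + frobNorm L ^ 2 := by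
  simp only [frob_sq, Matrix.transpose_sub, Matrix.sub_mul, Matrix.mul_sub, Matrix.trace_sub,
    tr_symm M L]
  ring

lemma frob_add {m n : ℕ} (M L : Matrix (Fin m) (Fin n) ℝ) :
    frobNorm (M + L) ^ 2 = frobNorm M ^ 2 + 2 * Matrix.trace (Mᵀ * L) + frobNorm L ^ 2 := by
  simp only [frob_sq, Matrix.transpose_add, Matrix.add_mul, Matrix.mul_add, Matrix.trace_add,
    tr_symm M L]
  ring

lemma frob_orth {n d k : ℕ} (U : Matrix (Fin n) (Fin k) ℝ) (B : Matrix (Fin d) (Fin k) ℝ)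
    (hB : Bᵀ * B = 1) : frobNorm (U * Bᵀ) ^ 2 = frobNorm U ^ 2 := by
  rw [frob_sq, frob_sq, Matrix.transpose_mul, Matrix.transpose_transpose, Matrix.mul_assoc,
    Matrix.trace_mul_comm, Matrix.mul_assoc, Matrix.mul_assoc, hB, Matrix.mul_one]

open scoped Matrix.Norms.L2Operator in
lemma frob_mul_le {n k d : ℕ} (U : Matrix (Fin n) (Fin k) ℝ) (D : Matrix (Fin k) (Fin d) ℝ) :
    frobNorm (U * D) ^ 2 ≤ specNorm D ^ 2 * frobNorm U ^ 2 := by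
  have hs : specNorm D = ‖Dᵀ‖ := by
    rw [← Matrix.conjTranspose_eq_transpose_of_trivial, Matrix.l2_opNorm_conjTranspose]
    rfl
  rw [hs, frobNorm, frobNorm, Real.sq_sqrt (by positivity), Real.sq_sqrt (by positivity),
    Finset.mul_sum]
  refine Finset.sum_le_sum fun i _ => ?_
  have h := Matrix.l2_opNorm_mulVec Dᵀ (WithLp.toLp 2 (U i))
  have h2 := pow_le_pow_left₀ (norm_nonneg _) h 2
  rw [mul_pow, EuclideanSpace.norm_sq_eq, EuclideanSpace.norm_sq_eq] at h2
  simpa [Matrix.mulVec, dotProduct, Matrix.mul_apply, mul_comm] using h2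

lemma rk_add {n d : ℕ} (X Y : Matrix (Fin n) (Fin d) ℝ) : (X + Y).rank ≤ X.rank + Y.rank := by
  unfold Matrix.rank
  rw [Matrix.mulVecLin_add]
  refine (Submodule.finrank_mono ?_).trans
    (Submodule.finrank_add_le_finrank_add_finrank _ _)
  rintro _ ⟨v, rfl⟩
  exact Submodule.add_mem_sup ⟨v, rfl⟩ ⟨v, rfl⟩

lemma rank_le_k {n d k : ℕ} (U : Matrix (Fin n) (Fin k) ℝ) (B : Matrix (Fin k) (Fin d) ℝ) :
    (U * B).rank ≤ k :=
  (Matrix.rank_mul_le_left U B).trans (by simpa using U.rank_le_width)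

theorem stmt5 {n d N k : ℕ} (hn : 0 < n) (hd : 0 < d) (hN : 0 < N) (hk : 0 < k)
    (A : Matrix (Fin n) (Fin d) ℝ →ₗ[ℝ] EuclideanSpace ℝ (Fin N))
    (Astar : EuclideanSpace ℝ (Fin N) →ₗ[ℝ] Matrix (Fin n) (Fin d) ℝ)
    (hadj : ∀ (M : Matrix (Fin n) (Fin d) ℝ) (y : EuclideanSpace ℝ (Fin N)),
      ⟪A M, y⟫ = Matrix.trace (Mᵀ * Astar y))
    (δ : ℝ) (hδ0 : 0 ≤ δ) (hδ1 : δ < 1) (hRIP : RIP A (2 * k) δ)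
    (Bstar Bt : Matrix (Fin d) (Fin k) ℝ)
    (hBstar : Bstarᵀ * Bstar = 1) (hBt : Btᵀ * Bt = 1) :
    ∀ U : Matrix (Fin n) (Fin k) ℝ, frobNorm U = 1 →
      1 - pdist Bt Bstar ^ 2 - δ * (1 + Real.sqrt k + k * δ) ≤
        frobNorm ((Astar (A (U * Bstarᵀ))) * Bt) ^ 2 := by
  intro U hU
  have hX : frobNorm (U * Bstarᵀ) ^ 2 = 1 := by rw [frob_orth U Bstar hBstar, hU]; norm_num
  have hrX : (U * Bstarᵀ).rank ≤ k := rank_le_k _ _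
  have hR0 : frobNorm (U * (Bstarᵀ * (Bt * Btᵀ - 1))) ^ 2 ≤ pdist Bt Bstar ^ 2 := by
    have := frob_mul_le U (Bstarᵀ * (Bt * Btᵀ - 1))
    rwa [hU, one_pow, mul_one] at this
  have hRe : U * (Bstarᵀ * (Bt * Btᵀ - 1)) = (U * Bstarᵀ * Bt) * Btᵀ - U * Bstarᵀ := by
    simp only [Matrix.mul_sub, Matrix.mul_one, Matrix.mul_assoc]
  rw [hRe] at hR0
  generalize U * Bstarᵀ = X at *
  obtain ⟨P, hP⟩ : ∃ P, P = X * Bt := ⟨_, rfl⟩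
  rw [← hP] at hR0
  have hY := frob_orth P Bt hBt
  have hrY : (P * Btᵀ).rank ≤ k := rank_le_k _ _
  have hYX : Matrix.trace ((P * Btᵀ)ᵀ * X) = frobNorm P ^ 2 := by
    rw [frob_sq, Matrix.transpose_mul, Matrix.transpose_transpose, Matrix.mul_assoc,
      Matrix.trace_mul_comm, Matrix.mul_assoc, ← hP]
  have hPC : ⟪A (P * Btᵀ), A X⟫ = Matrix.trace (Pᵀ * (Astar (A X) * Bt)) := by
    rw [hadj, Matrix.transpose_mul, Matrix.transpose_transpose, Matrix.mul_assoc,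
      Matrix.trace_mul_comm, Matrix.mul_assoc]
  generalize P * Btᵀ = Y at *
  rw [frob_sub] at hR0
  have hnn : 0 ≤ frobNorm (Y - X) ^ 2 := sq_nonneg _
  rw [frob_sub] at hnn
  have h1 := (hRIP (Y + X) ((rk_add _ _).trans (by omega))).1
  have h2 := (hRIP (Y - X) (by
    rw [sub_eq_add_neg]
    refine (rk_add _ _).trans ?_
    have : (-X).rank ≤ X.rank := by
      have := Matrix.rank_mul_le_left X (-1 : Matrix (Fin d) (Fin d) ℝ)
      simpa using this
    omega)).2
  rw [frob_add, map_add, norm_add_sq_real] at h1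
  rw [frob_sub, map_sub, norm_sub_sq_real] at h2
  rw [hYX, hX, hY] at hR0 hnn h1 h2
  have h3 : 0 ≤ frobNorm (P - Astar (A X) * Bt) ^ 2 := sq_nonneg _
  rw [frob_sub, ← hPC] at h3
  have hs : 1 ≤ Real.sqrt k := by
    rw [Real.one_le_sqrt]; exact_mod_cast hk
  have h4 : δ * 2 ≤ δ * (1 + Real.sqrt k + k * δ) := by
    apply mul_le_mul_of_nonneg_left _ hδ0
    have : 0 ≤ (k:ℝ) * δ := by positivity
    linarith
  have h5 : δ * frobNorm P ^ 2 ≤ δ * 1 := mul_le_mul_of_nonneg_left (by linarith) hδ0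
  linarith
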